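/- Let n ≥ 1, T > 0, and let u be a smooth solution of the biharmonic heat equation on ℝⁿ × (0,T]. Assume: (i) for every compact set Ω ⊂ ℝⁿ, ∫_Ω u(x,t)² dx → 0 as t → 0⁺; and (ii) there exist a constant a > 0, a constant R* ≥ 1, and a nondecreasing function L : [1,∞) → (0,∞) with ∫₁^∞ r³ / L(r)³ dr = ∞, such that ∫₀^T t^a ∫_{B(0,R)} u(x,t)² dx dt ≤ exp(L(R)) for every R ≥ R*. Then u(x,t) = 0 for all (x,t) ∈ ℝⁿ × (0,T]. -/

import Mathlib

open MeasureTheory Metric Set Filter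

/-- The Euclidean Laplacian `Δf = ∑ᵢ ∂²f/∂xᵢ²`. -/
noncomputable def lap {n : ℕ} (f : EuclideanSpace ℝ (Fin n) → ℝ) :
    EuclideanSpace ℝ (Fin n) → ℝ :=
  fun x => ∑ i : Fin n,
    fderiv ℝ (fun y => fderiv ℝ f y (EuclideanSpace.single i 1)) x (EuclideanSpace.single i 1)

/-- `u = u(x,t)` is a smooth solution of the biharmonic heat equation
`∂ₜu = -Δ²u` on the set `S ⊆ ℝⁿ × ℝ`. -/
def IsBiharmonicHeatSol {n : ℕ} (u : EuclideanSpace ℝ (Fin n) → ℝ → ℝ)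
    (S : Set (EuclideanSpace ℝ (Fin n) × ℝ)) : Prop :=
  ContDiffOn ℝ (⊤ : ℕ∞) (fun p => u p.1 p.2) S ∧
  ∀ p ∈ S, HasDerivWithinAt (fun s => u p.1 s)
    (-(lap (lap (fun y => u y p.2)) p.1)) {s | (p.1, s) ∈ S} p.2

theorem iterate_energy {E : ℕ → ℝ → ℝ} {N : ℕ} {K A B τ T : ℝ} (hK : 0 ≤ K)
    (hcont : ∀ j, Continuous (E j)) (hA : ∀ j ≤ N, E j τ ≤ A)
    (hB : ∀ s, τ ≤ s → s ≤ T → E N s ≤ B)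
    (hstep : ∀ j < N, ∀ t, τ ≤ t → t ≤ T →
      E j t ≤ E (j + 1) τ + K * ∫ s in τ..t, E (j + 1) s) :
    ∀ k ≤ N, ∀ t, τ ≤ t → t ≤ T →
      E (N - k) t ≤ A * ∑ i ∈ Finset.range k, (K * (t - τ)) ^ i / (i.factorial : ℝ)
        + B * ((K * (t - τ)) ^ k / (k.factorial : ℝ)) := by
  have key : ∀ (i : ℕ) (t : ℝ), K * ∫ s in τ..t, (K * (s - τ)) ^ i / (i.factorial : ℝ) =
      (K * (t - τ)) ^ (i + 1) / ((i + 1).factorial : ℝ) := by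
    intro i t
    have h1 : (∫ s in τ..t, (K * (s - τ)) ^ i / (i.factorial : ℝ)) =
        ∫ s in τ..t, (K ^ i / (i.factorial : ℝ)) * (s - τ) ^ i := by
      congr 1; ext s; rw [mul_pow]; ring
    rw [h1, intervalIntegral.integral_const_mul,
      intervalIntegral.integral_comp_sub_right (fun x => x ^ i), integral_pow]
    have : (i.factorial : ℝ) ≠ 0 := by positivity
    have : (i : ℝ) + 1 ≠ 0 := by positivity
    rw [Nat.factorial_succ]
    push_cast
    rw [mul_pow]
    field_simp
    simp
    ring
  intro k
  induction k with
  | zero => intro _ t h1 h2; simpa using hB t h1 h2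
  | succ k ih =>
    intro hk t h1 h2
    have e : N - (k + 1) + 1 = N - k := by omega
    have h := hstep (N - (k + 1)) (by omega) t h1 h2
    rw [e] at h
    have hint : ∫ s in τ..t, E (N - k) s ≤ ∫ s in τ..t,
        (A * ∑ i ∈ Finset.range k, (K * (s - τ)) ^ i / (i.factorial : ℝ)
        + B * ((K * (s - τ)) ^ k / (k.factorial : ℝ))) := by
      apply intervalIntegral.integral_mono_on h1 ((hcont _).intervalIntegrable _ _)
      · apply Continuous.intervalIntegrable; fun_prop
      · intro s hs; exact ih (by omega) s hs.1 (hs.2.trans h2)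
    rw [intervalIntegral.integral_add (by apply Continuous.intervalIntegrable; fun_prop)
      (by apply Continuous.intervalIntegrable; fun_prop),
      intervalIntegral.integral_const_mul, intervalIntegral.integral_const_mul,
      intervalIntegral.integral_finsetSum
        (fun i _ => by apply Continuous.intervalIntegrable; fun_prop)] at hint
    have h3 := mul_le_mul_of_nonneg_left hint hK
    have h4 : K * (A * ∑ i ∈ Finset.range k, ∫ s in τ..t, (K * (s - τ)) ^ i / (i.factorial : ℝ)) =
        A * ∑ i ∈ Finset.range k, (K * (t - τ)) ^ (i + 1) / ((i + 1).factorial : ℝ) := by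
      rw [mul_left_comm, Finset.mul_sum]
      congr 1
      exact Finset.sum_congr rfl fun i _ => key i t
    rw [mul_add, h4, mul_left_comm K B, key] at h3
    rw [Finset.sum_range_succ']
    have h5 := hA (N - k) (by omega)
    simp only [pow_zero, Nat.factorial_zero, Nat.cast_one, div_one]
    linarith

/-- One time step of the Täcklind iteration. -/
theorem energy_step {E : ℝ → ℝ → ℝ} {C T ρ r τ t B : ℝ} {N : ℕ} (hC : 0 ≤ C) (hN : 0 < N)
    (hE0 : ∀ t r, 0 ≤ E t r) (hmono : ∀ t, Monotone (E t))
    (hcont : ∀ r, Continuous (fun t => E t r))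
    (hen : ∀ ρ r τ t, 0 < ρ → ρ < r → τ ≤ t → t ≤ T →
      E t ρ ≤ E τ r + C / (r - ρ) ^ 4 * ∫ s in τ..t, E s r)
    (hρ : 0 < ρ) (hr : ρ < r) (hτ : τ ≤ t) (ht : t ≤ T) (hB : ∀ s ≤ T, E s r ≤ B) :
    E t ρ ≤ Real.exp (C * N ^ 4 / (r - ρ) ^ 4 * (t - τ)) * E τ r
      + B * ((C * N ^ 4 / (r - ρ) ^ 4 * (t - τ)) ^ N / (N.factorial : ℝ)) := by
  have hN' : (0 : ℝ) < N := by exact_mod_cast hN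
  set d : ℝ := (r - ρ) / N with hd
  have hd0 : 0 < d := div_pos (by linarith) hN'
  have hKd : C * N ^ 4 / (r - ρ) ^ 4 = C / d ^ 4 := by
    have : r - ρ ≠ 0 := by linarith
    rw [hd]; field_simp
  have hrN : ρ + N * d = r := by rw [hd]; field_simp; ring
  rw [hKd]
  have hK : 0 ≤ C / d ^ 4 := by positivity
  have h := iterate_energy (E := fun j s => E s (ρ + j * d)) (N := N) (K := C / d ^ 4)
    (A := E τ r) (B := B) (τ := τ) (T := T) hK (fun j => hcont _)
    (fun j hj => hmono τ (by
      rw [← hrN]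
      have : (j : ℝ) ≤ N := by exact_mod_cast hj
      gcongr))
    (fun s _ h2 => by simpa only [hrN] using hB s h2)
    (fun j _ t h1 h2 => by
      have := hen (ρ + j * d) (ρ + (j + 1 : ℕ) * d) τ t (by positivity)
        (by push_cast; linarith) h1 h2
      have e : ρ + (j + 1 : ℕ) * d - (ρ + j * d) = d := by push_cast; ring
      rwa [e] at this)
    N le_rfl t hτ ht
  simp only [Nat.sub_self, Nat.cast_zero, zero_mul, add_zero] at h
  refine h.trans ?_
  rw [mul_comm (E τ r)]
  gcongr
  · exact hE0 _ _
  · exact Real.sum_le_exp_of_nonneg (by apply mul_nonneg hK; linarith) _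

/-- A weighted time-integrated bound improves to a uniform bound on a smaller ball. -/
theorem energy_sup_bound {C a : ℝ} (hC : 0 < C) (ha : 0 < a) :
    ∃ C', 0 ≤ C' ∧ ∀ {E : ℝ → ℝ → ℝ} {T R W : ℝ}, 0 ≤ T →
    (∀ t r, 0 ≤ E t r) → (∀ t, Monotone (E t)) →
    (∀ r, Continuous (fun t => E t r)) → (∀ t ≤ 0, ∀ r, E t r = 0) →
    (∀ ρ r τ t, 0 < ρ → ρ < r → τ ≤ t → t ≤ T →
      E t ρ ≤ E τ r + C / (r - ρ) ^ 4 * ∫ s in τ..t, E s r) →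
    1 ≤ R → (∫ s in (0:ℝ)..T, s ^ a * E s (2 * R)) ≤ W →
    ∀ s ≤ T, E s R ≤ C' * W := by
  set p : ℝ := 4 + 4 * a with hp
  set κ : ℝ := 1 / (2 ^ (p + 1) * C) with hκ
  have hκ0 : 0 < κ := by positivity
  refine ⟨2 * (2 ^ p * C * κ ^ (-a)), by positivity, ?_⟩
  intro E T R W hT hE0 hmono hcont hneg hen hR hW
  have hwc : Continuous fun s : ℝ => s ^ a * E s (2 * R) :=
    (Real.continuous_rpow_const ha.le).mul (hcont _)
  have hW0 : 0 ≤ W := le_trans (intervalIntegral.integral_nonneg hT fun s hs =>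
    mul_nonneg (Real.rpow_nonneg hs.1 _) (hE0 _ _)) hW
  -- the weighted supremum
  set S : Set ℝ := {q | ∃ s ρ, s ≤ T ∧ R ≤ ρ ∧ ρ < 2 * R ∧ q = (2 * R - ρ) ^ p * E s ρ} with hS
  obtain ⟨b, hb⟩ : ∃ b, ∀ s ≤ T, E s (2 * R) ≤ b := by
    obtain ⟨b, hb⟩ := (isCompact_Icc (a := (0:ℝ)) (b := T)).bddAbove_image
      (hcont (2 * R)).continuousOn
    refine ⟨max b 0, fun s hs => ?_⟩
    rcases le_total s 0 with h | h
    · rw [hneg s h]; exact le_max_right _ _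
    · exact le_max_of_le_left (hb (mem_image_of_mem _ ⟨h, hs⟩))
  have hbdd : BddAbove S := by
    refine ⟨(2 * R) ^ p * b, ?_⟩
    rintro q ⟨s, ρ, hs, h1, h2, rfl⟩
    have := hb s hs
    have h3 := hmono s h2.le
    have : (2 * R - ρ) ^ p ≤ (2 * R) ^ p :=
      Real.rpow_le_rpow (by linarith) (by linarith) (by positivity)
    have := hE0 s ρ
    gcongr
    exact h3.trans (hb s hs)
  set Q := sSup S with hQ
  have hle : ∀ s ρ, s ≤ T → R ≤ ρ → ρ < 2 * R → (2 * R - ρ) ^ p * E s ρ ≤ Q :=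
    fun s ρ h1 h2 h3 => le_csSup hbdd ⟨s, ρ, h1, h2, h3, rfl⟩
  have hQ0 : 0 ≤ Q := le_trans (mul_nonneg (Real.rpow_nonneg (by linarith) _) (hE0 _ _))
    (hle T R le_rfl le_rfl (by linarith))
  have himp : ∀ s ρ, s ≤ T → R ≤ ρ → ρ < 2 * R →
      (2 * R - ρ) ^ p * E s ρ ≤ Q / 2 + 2 ^ p * C * κ ^ (-a) * W := by
    intro s ρ hs h1 h2
    rcases le_total s 0 with hs0 | hs0
    · rw [hneg s hs0, mul_zero]; positivity
    set d := (2 * R - ρ) / 2 with hd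
    have hd0 : 0 < d := by rw [hd]; linarith
    have e1 : 2 * R - ρ = 2 * d := by rw [hd]; ring
    have h3 := hen ρ (ρ + d) 0 s (by linarith) (by linarith) hs0 hs
    rw [hneg 0 le_rfl, zero_add, add_sub_cancel_left] at h3
    set ε := κ * d ^ 4 with hε
    have hε0 : 0 < ε := by positivity
    have hpt : ∀ σ, σ ≤ s → E σ (ρ + d) ≤ Q / d ^ p := by
      intro σ hσ
      have := hle σ (ρ + d) (hσ.trans hs) (by linarith) (by rw [hd]; linarith)
      have e : 2 * R - (ρ + d) = d := by rw [hd]; ring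
      rw [e] at this
      rw [le_div_iff₀ (by positivity)]; linarith
    have hI : ∫ σ in (0:ℝ)..s, E σ (ρ + d) ≤ ε * (Q / d ^ p) + ε ^ (-a) * W := by
      set m := min ε s with hm
      have hm0 : 0 ≤ m := le_min hε0.le hs0
      have hms : m ≤ s := min_le_right _ _
      rw [← intervalIntegral.integral_add_adjacent_intervals (b := m)
        ((hcont _).intervalIntegrable _ _) ((hcont _).intervalIntegrable _ _)]
      gcongr ?_ + ?_
      · calc ∫ σ in (0:ℝ)..m, E σ (ρ + d) ≤ ∫ σ in (0:ℝ)..m, Q / d ^ p :=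
              intervalIntegral.integral_mono_on hm0 ((hcont _).intervalIntegrable _ _)
                (by simp) fun σ hσ => hpt σ (hσ.2.trans hms)
          _ = m * (Q / d ^ p) := by rw [intervalIntegral.integral_const]; simp
          _ ≤ ε * (Q / d ^ p) := by gcongr; exact min_le_left _ _
      · calc ∫ σ in m..s, E σ (ρ + d) ≤ ∫ σ in m..s, ε ^ (-a) * (σ ^ a * E σ (2 * R)) := by
              apply intervalIntegral.integral_mono_on_of_le_Ioo hms ((hcont _).intervalIntegrable _ _)
                ((hwc.const_mul _).intervalIntegrable _ _)
              intro σ hσ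
              rcases le_or_gt ε s with h | h
              · have hεσ : ε ≤ σ := by have := hσ.1; rw [hm, min_eq_left h] at this; exact this.le
                have h5 : 1 ≤ ε ^ (-a) * σ ^ a := by
                  rw [Real.rpow_neg hε0.le, inv_mul_eq_div, one_le_div (by positivity)]
                  exact Real.rpow_le_rpow hε0.le hεσ ha.le
                have h6 : E σ (ρ + d) ≤ E σ (2 * R) := hmono σ (by rw [hd]; linarith)
                rw [← mul_assoc]
                calc _ ≤ E σ (2 * R) := h6
                  _ ≤ _ := le_mul_of_one_le_left (hE0 _ _) h5
              · rw [hm, min_eq_right h.le] at hσ; exact absurd (hσ.1.trans hσ.2) (lt_irrefl _)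
          _ = ε ^ (-a) * ∫ σ in m..s, (σ ^ a * E σ (2 * R)) := by
              rw [intervalIntegral.integral_const_mul]
          _ ≤ ε ^ (-a) * W := by
              gcongr
              refine le_trans ?_ hW
              apply intervalIntegral.integral_mono_interval hm0 hms hs
              · refine (ae_restrict_mem measurableSet_Ioc).mono fun σ hσ => ?_
                exact mul_nonneg (Real.rpow_nonneg hσ.1.le _) (hE0 _ _)
              · exact hwc.intervalIntegrable _ _
    have h7 : E s ρ ≤ C / d ^ 4 * (ε * (Q / d ^ p) + ε ^ (-a) * W) := h3.trans (by gcongr)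
    have h8 : (2 * R - ρ) ^ p = 2 ^ p * d ^ p := by
      rw [e1, Real.mul_rpow (by norm_num) hd0.le]
    have h9 : d ^ p = d ^ 4 * d ^ (4 * a) := by
      rw [hp, Real.rpow_add hd0]; norm_cast
    have h10 : ε ^ (-a) = κ ^ (-a) / d ^ (4 * a) := by
      rw [hε, Real.mul_rpow hκ0.le (by positivity), ← Real.rpow_natCast, ← Real.rpow_mul hd0.le,
        div_eq_mul_inv, ← Real.rpow_neg hd0.le]
      norm_num
    have hda : 0 < d ^ (4 * a) := by positivity
    calc (2 * R - ρ) ^ p * E s ρ ≤ 2 ^ p * d ^ p *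
          (C / d ^ 4 * (ε * (Q / d ^ p) + ε ^ (-a) * W)) := by rw [h8]; gcongr
      _ = 2 ^ p * C * κ * Q + 2 ^ p * C * κ ^ (-a) * W := by
          rw [h10, h9, hε]; field_simp
      _ = _ := by
          have : (2:ℝ) ^ p * C * κ = 1 / 2 := by
            rw [hκ, Real.rpow_add (x := 2) (by norm_num) p 1, Real.rpow_one]; field_simp
          rw [this]; ring
  have hQle : Q ≤ Q / 2 + 2 ^ p * C * κ ^ (-a) * W := by
    have hne : S.Nonempty := ⟨_, T, R, le_rfl, le_rfl, by linarith, rfl⟩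
    refine csSup_le hne ?_
    rintro q ⟨s, ρ, h1, h2, h3, rfl⟩
    exact himp s ρ h1 h2 h3
  intro s hs
  have h := hle s R hs le_rfl (by linarith)
  have e : 2 * R - R = R := by ring
  rw [e] at h
  have h1 : (1:ℝ) ≤ R ^ p := Real.one_le_rpow hR (by positivity)
  have := le_mul_of_one_le_left (hE0 s R) h1
  linarith

/-- The divergence condition on the growth function, recast along the dyadic levels of `L`. -/
theorem exists_dyadic_radii {L : ℝ → ℝ} (hL : MonotoneOn L (Ici (1:ℝ)))
    (hL0 : ∀ r ∈ Ici (1:ℝ), 0 < L r)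
    (hdiv : (∫⁻ r in Ici (1:ℝ), ENNReal.ofReal (r ^ 3 / (L r) ^ 3)) = ⊤) {R : ℝ} (hR : 1 ≤ R) :
    ∃ r : ℕ → ℝ, Monotone r ∧ (∀ m, R ≤ r m) ∧ (∃ m₀, ∀ m ≥ m₀, L (4 * r m) ≤ 2 ^ m) ∧
      ¬ Summable (fun m : ℕ => r m ^ 4 / 8 ^ m) := by
  set A : ℕ → Set ℝ := fun m => {r | 1 ≤ r ∧ r ≤ 2 ^ m ∧ L r ≤ 2 ^ m} with hA
  have hAmono : Monotone A := by
    intro i j hij r ⟨h1, h2, h3⟩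
    have : (2:ℝ) ^ i ≤ 2 ^ j := pow_le_pow_right₀ (by norm_num) hij
    exact ⟨h1, h2.trans this, h3.trans this⟩
  have hpow : ∀ x : ℝ, ∃ m₀ : ℕ, ∀ m ≥ m₀, x ≤ 2 ^ m := by
    intro x
    obtain ⟨m, hm⟩ := pow_unbounded_of_one_lt x (one_lt_two)
    exact ⟨m, fun k hk => hm.le.trans (pow_le_pow_right₀ (by norm_num) hk)⟩
  have hmem : ∀ r, 1 ≤ r → ∃ m₀ : ℕ, ∀ m ≥ m₀, r ∈ A m := by
    intro r hr
    obtain ⟨m1, h1⟩ := hpow r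
    obtain ⟨m2, h2⟩ := hpow (L r)
    exact ⟨max m1 m2, fun m hm => ⟨hr, h1 m ((le_max_left _ _).trans hm),
      h2 m ((le_max_right _ _).trans hm)⟩⟩
  obtain ⟨m₀, hm₀⟩ := hmem (8 * R) (by linarith)
  have hbdd : ∀ m, BddAbove (A m) := fun m => ⟨2 ^ m, fun r hr => hr.2.1⟩
  set q : ℕ → ℝ := fun m => sSup (A (max m m₀)) with hq
  have hq8 : ∀ m, 8 * R ≤ q m := fun m => le_csSup (hbdd _) (hm₀ _ (le_max_right _ _))
  have hqmono : Monotone q := fun i j hij =>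
    csSup_le_csSup (hbdd _) ⟨_, hm₀ _ (le_max_right _ _)⟩ (hAmono (max_le_max_right _ hij))
  refine ⟨fun m => q m / 8, fun i j hij => by have := hqmono hij; simp only; linarith,
    fun m => by have := hq8 m; linarith, ⟨m₀, fun m hm => ?_⟩, fun hsum => ?_⟩
  · have h8 := hq8 m
    obtain ⟨r, hr, hlt⟩ := exists_lt_of_lt_csSup ⟨_, hm₀ _ (le_max_right m m₀)⟩
      (show q m / 2 < sSup (A (max m m₀)) by change _ < q m; linarith)
    rw [max_eq_left hm] at hr
    refine le_trans (hL ?_ hr.1 ?_) hr.2.2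
    · simp only [mem_Ici]; linarith
    · linarith
  · have hsum' : Summable (fun m : ℕ => q m ^ 4 / 8 ^ m) := by
      refine (hsum.mul_left (8 ^ 4)).congr fun m => ?_
      rw [div_pow]; field_simp
    have hqpos : ∀ m, 0 < q m := fun m => by have := hq8 m; linarith
    obtain ⟨m₁, hm₁⟩ : ∃ m₁ : ℕ, ∀ m ≥ m₁, q m < 2 ^ m / 2 := by
      have h := hsum'.tendsto_atTop_zero.eventually (gt_mem_nhds (show (0:ℝ) < 1 / 16 by norm_num))
      obtain ⟨m₁, h⟩ := eventually_atTop.1 h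
      refine ⟨m₁, fun m hm => ?_⟩
      have h1 := h m hm
      by_contra! h2
      have h3 : (2 ^ m / 2 : ℝ) ^ 4 ≤ q m ^ 4 := by gcongr
      rw [div_lt_iff₀ (by positivity)] at h1
      have h4 : (2 ^ m / 2 : ℝ) ^ 4 = 8 ^ m * 2 ^ m / 16 := by
        rw [div_pow, ← pow_mul, mul_comm m 4, pow_mul, ← mul_pow]; norm_num
      have h5 : (1:ℝ) ≤ 2 ^ m := one_le_pow₀ (by norm_num)
      have h6 : (0:ℝ) < 8 ^ m := by positivity
      nlinarith
    set k := max m₀ m₁ with hk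
    have hqk : ∀ m ≥ k, q m = sSup (A m) := fun m hm => by
      rw [hq]; simp only; rw [max_eq_left ((le_max_left _ _).trans hm)]
    have hAm : ∀ m, MeasurableSet (A m) := by
      intro m
      apply OrdConnected.measurableSet
      refine ⟨fun x hx y hy z hz => ⟨hx.1.trans hz.1, hz.2.trans hy.2.1, ?_⟩⟩
      exact (hL (hx.1.trans hz.1) hy.1 hz.2).trans hy.2.2
    set D : ℕ → Set ℝ := fun m => A (k + m + 1) \ A (k + m) with hD
    have hcover : Ici (1:ℝ) ⊆ A k ∪ ⋃ m, D m := by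
      intro r hr
      by_contra hcon
      simp only [mem_union, mem_iUnion, not_or, not_exists, hD, Set.mem_sdiff, not_and, not_not] at hcon
      have : ∀ m, r ∉ A (k + m) := by
        intro m
        induction m with
        | zero => exact hcon.1
        | succ m ih => exact fun h => ih (hcon.2 m h)
      obtain ⟨m, hm⟩ := hmem r hr
      exact this m (hm _ (by omega))
    have hint : ∀ (s : Set ℝ) (c b : ℝ), MeasurableSet s → s ⊆ Icc 1 b → 0 ≤ c → 0 ≤ b →
        (∀ r ∈ s, r ^ 3 / L r ^ 3 ≤ c) →
        ∫⁻ r in s, ENNReal.ofReal (r ^ 3 / (L r) ^ 3) ≤ ENNReal.ofReal (c * b) := by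
      intro s c b hs hsub hc hb h
      calc ∫⁻ r in s, ENNReal.ofReal (r ^ 3 / (L r) ^ 3) ≤ ∫⁻ r in s, ENNReal.ofReal c :=
            setLIntegral_mono' hs fun r hr => ENNReal.ofReal_le_ofReal (h r hr)
        _ = ENNReal.ofReal c * volume s := by simp
        _ ≤ ENNReal.ofReal c * volume (Icc 1 b) := by gcongr
        _ = ENNReal.ofReal c * ENNReal.ofReal (b - 1) := by rw [Real.volume_Icc]
        _ ≤ ENNReal.ofReal c * ENNReal.ofReal b := by gcongr; linarith
        _ = _ := (ENNReal.ofReal_mul hc).symm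
    have hDsub : ∀ m, ∫⁻ r in D m, ENNReal.ofReal (r ^ 3 / (L r) ^ 3) ≤
        ENNReal.ofReal (8 * (q (m + (k + 1)) ^ 4 / 8 ^ (m + (k + 1)))) := by
      intro m
      have e : m + (k + 1) = k + m + 1 := by omega
      rw [e]
      have hle : ∀ r ∈ A (k + m + 1), r ≤ q (k + m + 1) := fun r hr => by
        rw [hqk _ (by omega)]; exact le_csSup (hbdd _) hr
      refine (hint (D m) (q (k + m + 1) ^ 3 / (2 ^ (k + m)) ^ 3) (q (k + m + 1))
        ((hAm _).diff (hAm _)) (fun r hr => ⟨hr.1.1, hle r hr.1⟩)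
        (by have := hqpos (k + m + 1); positivity) (hqpos _).le ?_).trans ?_
      · rintro r ⟨hr1, hr2⟩
        have h1 := hle r hr1
        have h2 := hm₁ (k + m + 1) ((le_max_right _ _).trans (show k ≤ k + m + 1 by omega))
        rw [pow_succ, mul_div_assoc, div_self two_ne_zero, mul_one] at h2
        have h3 : 2 ^ (k + m) < L r := by
          by_contra! h
          exact hr2 ⟨hr1.1, by linarith, h⟩
        have := hr1.1
        have := (hqpos (k + m + 1)).le
        gcongr
      · apply ENNReal.ofReal_le_ofReal
        have : (8:ℝ) ^ (k + m + 1) = 8 * (2 ^ (k + m)) ^ 3 := by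
          rw [pow_succ, ← pow_mul, mul_comm (k + m) 3, pow_mul]; norm_num; ring
        rw [this]
        apply le_of_eq
        field_simp
    have hAk : ∫⁻ r in A k, ENNReal.ofReal (r ^ 3 / (L r) ^ 3) ≤
        ENNReal.ofReal ((2 ^ k) ^ 3 / L 1 ^ 3 * 2 ^ k) := by
      have hL1 := hL0 1 (by simp)
      refine hint (A k) _ _ (hAm k) (fun r hr => ⟨hr.1, hr.2.1⟩) (by positivity) (by positivity) ?_
      intro r hr
      have h1 : L 1 ≤ L r := hL (by simp) hr.1 hr.1
      have := hr.1
      have := hr.2.1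
      gcongr
    have hsum2 : Summable fun m => 8 * (q (m + (k + 1)) ^ 4 / 8 ^ (m + (k + 1))) :=
      (((summable_nat_add_iff (k + 1)).2 hsum')).mul_left 8
    have hfin : (∫⁻ r in Ici (1:ℝ), ENNReal.ofReal (r ^ 3 / (L r) ^ 3)) < ⊤ :=
      calc _ ≤ ∫⁻ r in A k ∪ ⋃ m, D m, ENNReal.ofReal (r ^ 3 / (L r) ^ 3) :=
            lintegral_mono_set hcover
        _ ≤ _ := lintegral_union_le _ _ _
        _ ≤ ENNReal.ofReal ((2 ^ k) ^ 3 / L 1 ^ 3 * 2 ^ k) +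
            ∑' m, ENNReal.ofReal (8 * (q (m + (k + 1)) ^ 4 / 8 ^ (m + (k + 1)))) := by
          gcongr
          exact (lintegral_iUnion_le _ _).trans (ENNReal.tsum_le_tsum hDsub)
        _ < ⊤ := ENNReal.add_lt_top.2 ⟨ENNReal.ofReal_lt_top, hsum2.tsum_ofReal_lt_top⟩
    exact hfin.ne hdiv

theorem not_summable_gaps {r : ℕ → ℝ} (hr : Monotone r) (h0 : 0 ≤ r 0)
    (h : ¬ Summable (fun m : ℕ => r m ^ 4 / 8 ^ m)) :
    ¬ Summable (fun m : ℕ => (r (m + 1) - r m) ^ 4 / 8 ^ (m + 1)) := by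
  intro hs
  apply h
  have hpos : ∀ m, 0 ≤ r m := fun m => h0.trans (hr (Nat.zero_le m))
  have hg0 : ∀ m, 0 ≤ (r (m + 1) - r m) ^ 4 / 8 ^ (m + 1) := fun m => by
    have := hr (Nat.le_succ m); simp only [Nat.succ_eq_add_one] at this
    have : 0 ≤ r (m + 1) - r m := by linarith
    positivity
  have hpt : ∀ x y : ℝ, 0 ≤ x → 0 ≤ y → (x + y) ^ 4 ≤ 4 * x ^ 4 + 10000 * y ^ 4 := by
    intro x y hx hy
    rcases le_total (3 * y) x with h | h
    · have : (x + y) ^ 4 ≤ (4 / 3 * x) ^ 4 := by gcongr; linarith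
      have h4 : 0 ≤ x ^ 4 := by positivity
      have h5 : 0 ≤ y ^ 4 := by positivity
      nlinarith
    · have : (x + y) ^ 4 ≤ (4 * y) ^ 4 := by gcongr; linarith
      have h4 : 0 ≤ x ^ 4 := by positivity
      have h5 : 0 ≤ y ^ 4 := by positivity
      nlinarith
  set S := ∑' m, (r (m + 1) - r m) ^ 4 / 8 ^ (m + 1) with hS
  refine summable_of_sum_range_le (c := 2 * (r 0 ^ 4 + 10000 * S)) (fun m => by
    have := hpos m; positivity) fun M => ?_
  have hM : ∑ m ∈ Finset.range (M + 1), r m ^ 4 / 8 ^ m ≤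
      r 0 ^ 4 + (1 / 2) * ∑ m ∈ Finset.range M, r m ^ 4 / 8 ^ m +
        10000 * ∑ m ∈ Finset.range M, (r (m + 1) - r m) ^ 4 / 8 ^ (m + 1) := by
    rw [Finset.sum_range_succ', Finset.mul_sum, Finset.mul_sum, add_assoc,
      ← Finset.sum_add_distrib, add_comm]
    gcongr with m _
    · simp
    · have := hpt (r m) (r (m + 1) - r m) (hpos m) (by
        have := hr (Nat.le_succ m); simp only [Nat.succ_eq_add_one] at this; linarith)
      rw [add_sub_cancel] at this
      calc r (m + 1) ^ 4 / 8 ^ (m + 1) ≤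
          (4 * r m ^ 4 + 10000 * (r (m + 1) - r m) ^ 4) / 8 ^ (m + 1) := by gcongr
        _ = _ := by rw [pow_succ]; field_simp; ring
  have h1 : ∑ m ∈ Finset.range M, r m ^ 4 / 8 ^ m ≤
      ∑ m ∈ Finset.range (M + 1), r m ^ 4 / 8 ^ m := by
    rw [Finset.sum_range_succ]
    have := hpos M
    have : 0 ≤ r M ^ 4 / 8 ^ M := by positivity
    linarith
  have h2 : ∑ m ∈ Finset.range M, (r (m + 1) - r m) ^ 4 / 8 ^ (m + 1) ≤ S :=
    hs.sum_le_tsum _ fun m _ => hg0 m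
  linarith

/-- A family of local energies with vanishing initial data which satisfies the local energy
inequality of order four and a Täcklind-type growth bound vanishes. -/
theorem energy_eq_zero {E : ℝ → ℝ → ℝ} {C T a R₀ : ℝ} {L : ℝ → ℝ} (hC : 0 < C) (ha : 0 < a)
    (hT : 0 ≤ T) (hR₀ : 1 ≤ R₀)
    (hE0 : ∀ t r, 0 ≤ E t r) (hmono : ∀ t, Monotone (E t))
    (hcont : ∀ r, Continuous (fun t => E t r)) (hneg : ∀ t ≤ 0, ∀ r, E t r = 0)
    (hen : ∀ ρ r τ t, 0 < ρ → ρ < r → τ ≤ t → t ≤ T →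
      E t ρ ≤ E τ r + C / (r - ρ) ^ 4 * ∫ s in τ..t, E s r)
    (hL : MonotoneOn L (Ici (1:ℝ))) (hL0 : ∀ r ∈ Ici (1:ℝ), 0 < L r)
    (hdiv : (∫⁻ r in Ici (1:ℝ), ENNReal.ofReal (r ^ 3 / (L r) ^ 3)) = ⊤)
    (hgrow : ∀ R, R₀ ≤ R → (∫ s in (0:ℝ)..T, s ^ a * E s R) ≤ Real.exp (L (2 * R))) :
    ∀ t ≤ T, ∀ r, E t r = 0 := by
  obtain ⟨C', hC', hsup⟩ := energy_sup_bound hC ha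
  obtain ⟨r, hrm, hrR, ⟨m₀, hLr⟩, hns⟩ := exists_dyadic_radii hL hL0 hdiv hR₀
  have hrpos : ∀ m, 0 < r m := fun m => by have := hrR m; linarith
  have hB : ∀ m ≥ m₀, ∀ s ≤ T, E s (r m) ≤ C' * Real.exp (2 ^ m) := by
    intro m hm
    refine hsup hT hE0 hmono hcont hneg hen (hR₀.trans (hrR m)) ?_
    refine (hgrow (2 * r m) (by have := hrR m; have := hrpos m; linarith)).trans ?_
    rw [Real.exp_le_exp]
    have := hLr m hm
    rwa [show 2 * (2 * r m) = 4 * r m by ring]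
  set κ : ℝ := Real.exp (-4) with hκ
  have hκ0 : 0 < κ := Real.exp_pos _
  have hκ2 : κ ≤ 1 / 2 := by
    rw [hκ, Real.exp_neg, one_div]
    apply inv_anti₀ (by norm_num)
    have := Real.add_one_le_exp 4
    linarith
  set δ : ℕ → ℝ := fun m => κ / C * ((r (m + 1) - r m) ^ 4 / 8 ^ (m + 1)) with hδ
  have hδ0 : ∀ m, 0 ≤ δ m := fun m => by
    rw [hδ]; positivity
  have hstep : ∀ m ≥ m₀, ∀ t ≤ T, E t (r m) ≤
      Real.exp (2 ^ m) * E (t - δ m) (r (m + 1)) +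
        C' * Real.exp (-2 * 2 ^ (m + 1)) := by
    intro m hm t ht
    rcases (hrm (Nat.le_succ m)).eq_or_lt with h | h
    · simp only [Nat.succ_eq_add_one] at h
      have e : δ m = 0 := by rw [hδ]; simp [h]
      rw [e, sub_zero, ← h]
      have := Real.one_le_exp (x := 2 ^ m) (by positivity)
      have := le_mul_of_one_le_left (hE0 t (r m)) this
      have : 0 ≤ C' * Real.exp (-2 * 2 ^ (m + 1)) := by positivity
      linarith
    · simp only [Nat.succ_eq_add_one] at h
      have h1 := energy_step (N := 2 ^ (m + 1)) (τ := t - δ m) hC.le (by positivity) hE0 hmono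
        hcont hen (hrpos m) h (by have := hδ0 m; linarith) ht (hB (m + 1) (by omega))
      have e : C * ((2 ^ (m + 1) : ℕ) : ℝ) ^ 4 / (r (m + 1) - r m) ^ 4 * (t - (t - δ m)) =
          κ * 2 ^ (m + 1) := by
        have : r (m + 1) - r m ≠ 0 := by linarith
        have e8 : (8:ℝ) ^ (m + 1) = (2 ^ (m + 1)) ^ 3 := by
          rw [← pow_mul, mul_comm (m + 1) 3, pow_mul]; norm_num
        rw [sub_sub_cancel, hδ]
        push_cast
        rw [e8]
        field_simp
      rw [e] at h1
      refine h1.trans ?_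
      set N : ℕ := 2 ^ (m + 1) with hN
      have hNr : (2:ℝ) ^ (m + 1) = N := by rw [hN]; push_cast; rfl
      have hNm : (2:ℝ) ^ m = N / 2 := by rw [← hNr, pow_succ]; ring
      rw [hNr, hNm, mul_pow, mul_div_assoc, mul_assoc C']
      have := hE0 (t - δ m) (r (m + 1))
      have hN0 : (0:ℝ) ≤ N := by positivity
      gcongr
      · nlinarith
      · calc Real.exp N * (κ ^ N * ((N:ℝ) ^ N / (N.factorial : ℝ)))
            ≤ Real.exp N * (κ ^ N * Real.exp N) := by
              gcongr; exact Real.pow_div_factorial_le_exp _ hN0 N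
          _ = Real.exp (-2 * N) := by
              rw [hκ, ← Real.exp_nat_mul, ← Real.exp_add, ← Real.exp_add]; congr 1; ring
  have hiter : ∀ m ≥ m₀, ∀ k, ∀ t ≤ T, E t (r m) ≤
      Real.exp (2 ^ (m + k)) * E (t - ∑ j ∈ Finset.range k, δ (m + j)) (r (m + k)) +
        C' * ((1 / 2) ^ m - (1 / 2) ^ (m + k)) := by
    intro m hm k
    induction k with
    | zero =>
      intro t _
      simp only [add_zero, Finset.range_zero, Finset.sum_empty, sub_zero, sub_self, mul_zero]
      exact le_mul_of_one_le_left (hE0 _ _) (Real.one_le_exp (by positivity))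
    | succ k ih =>
      intro t ht
      have hs : 0 ≤ ∑ j ∈ Finset.range k, δ (m + j) := Finset.sum_nonneg fun j _ => hδ0 _
      have h1 := ih t ht
      have h2 := hstep (m + k) (by omega) (t - ∑ j ∈ Finset.range k, δ (m + j)) (by linarith)
      rw [Finset.sum_range_succ, ← sub_sub]
      have h3 := mul_le_mul_of_nonneg_left h2 (Real.exp_pos (2 ^ (m + k))).le
      have e1 : Real.exp (2 ^ (m + k)) * Real.exp (2 ^ (m + k)) =
          Real.exp (2 ^ (m + (k + 1))) := by
        rw [← Real.exp_add, ← add_assoc, pow_succ]; congr 1; ring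
      have e2 : Real.exp (2 ^ (m + k)) * Real.exp (-2 * 2 ^ (m + k + 1)) ≤
          (1 / 2) ^ (m + (k + 1)) := by
        rw [← Real.exp_add]
        have h4 : (2:ℝ) ^ (m + k) + -2 * 2 ^ (m + k + 1) ≤ - 2 ^ (m + k + 1) := by
          rw [pow_succ]; nlinarith [pow_pos (two_pos (α := ℝ)) (m + k)]
        refine (Real.exp_le_exp.2 h4).trans ?_
        rw [Real.exp_neg, one_div, inv_pow]
        apply inv_anti₀ (by positivity)
        have := Real.add_one_le_exp ((2:ℝ) ^ (m + k + 1))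
        rw [← add_assoc]
        linarith
      have e3 := mul_le_mul_of_nonneg_left e2 hC'
      rw [mul_add, ← mul_assoc, e1] at h3
      have e4 : (1 / 2 : ℝ) ^ (m + k) = 2 * (1 / 2) ^ (m + (k + 1)) := by
        rw [← add_assoc, pow_succ]; ring
      rw [e4] at h1
      rw [← add_assoc] at *
      nlinarith
  have hlim : ∀ m ≥ m₀, ∀ t ≤ T, E t (r m) ≤ C' * (1 / 2) ^ m := by
    intro m hm t ht
    have hnot : ¬ Summable (fun j => δ (m + j)) := by
      intro hs
      refine not_summable_gaps hrm (hrpos 0).le hns ?_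
      have h1 : Summable (fun j => δ (j + m)) := by simpa only [add_comm] using hs
      have h2 := (summable_nat_add_iff m).1 h1
      refine (h2.mul_left (C / κ)).congr fun j => ?_
      rw [hδ]; field_simp
    have htend := (not_summable_iff_tendsto_nat_atTop_of_nonneg (fun j => hδ0 (m + j))).1 hnot
    obtain ⟨k, hk⟩ := (htend.eventually_ge_atTop t).exists
    have h := hiter m hm k t ht
    rw [hneg (t - ∑ j ∈ Finset.range k, δ (m + j)) (by linarith), mul_zero, zero_add] at h
    refine h.trans ?_
    gcongr
    have : (0:ℝ) ≤ (1 / 2) ^ (m + k) := by positivity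
    linarith
  have hunb : ∀ x, ∃ m, x ≤ r m := by
    intro x
    by_contra! hx
    apply hns
    have hg : Summable fun m : ℕ => x ^ 4 * (1 / 8 : ℝ) ^ m :=
      (summable_geometric_of_lt_one (by norm_num) (by norm_num)).mul_left _
    refine Summable.of_nonneg_of_le (fun m => by have := hrpos m; positivity) (fun m => ?_) hg
    rw [one_div, inv_pow, ← div_eq_mul_inv]
    have := hrpos m
    have := hx m
    gcongr
  intro t ht x
  obtain ⟨m', hm'⟩ := hunb x
  refine le_antisymm ?_ (hE0 _ _)
  have htd : Tendsto (fun m : ℕ => C' * (1 / 2 : ℝ) ^ m) atTop (nhds (C' * 0)) :=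
    (tendsto_pow_atTop_nhds_zero_of_lt_one (by norm_num) (by norm_num)).const_mul _
  rw [mul_zero] at htd
  refine ge_of_tendsto htd ?_
  filter_upwards [eventually_ge_atTop m', eventually_ge_atTop m₀] with m h1 h2
  exact (hmono t (hm'.trans (hrm h1))).trans (hlim m h2 t ht)

/-- The `i`-th partial derivative. -/
noncomputable def pd {n : ℕ} (i : Fin n) (f : EuclideanSpace ℝ (Fin n) → ℝ) :
    EuclideanSpace ℝ (Fin n) → ℝ :=
  fun x => fderiv ℝ f x (EuclideanSpace.single i 1)

/-- The pointwise inner product of the gradients of two functions. -/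
noncomputable def gradInner {n : ℕ} (f g : EuclideanSpace ℝ (Fin n) → ℝ) :
    EuclideanSpace ℝ (Fin n) → ℝ :=
  fun x => ∑ i : Fin n, pd i f x * pd i g x

theorem lap_eq_sum_pd {n : ℕ} (f : EuclideanSpace ℝ (Fin n) → ℝ) (x) :
    lap f x = ∑ i : Fin n, pd i (pd i f) x := rfl

theorem ContDiff.pd {n : ℕ} {f : EuclideanSpace ℝ (Fin n) → ℝ} (hf : ContDiff ℝ (⊤ : ℕ∞) f)
    (i : Fin n) : ContDiff ℝ (⊤ : ℕ∞) (pd i f) :=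
  (hf.fderiv_right (m := (⊤ : ℕ∞)) le_rfl).clm_apply contDiff_const

theorem ContDiff.lap {n : ℕ} {f : EuclideanSpace ℝ (Fin n) → ℝ} (hf : ContDiff ℝ (⊤ : ℕ∞) f) :
    ContDiff ℝ (⊤ : ℕ∞) (lap f) :=
  ContDiff.sum fun i _ => (hf.pd i).pd i

theorem ContDiff.gradInner {n : ℕ} {f g : EuclideanSpace ℝ (Fin n) → ℝ}
    (hf : ContDiff ℝ (⊤ : ℕ∞) f) (hg : ContDiff ℝ (⊤ : ℕ∞) g) :
    ContDiff ℝ (⊤ : ℕ∞) (gradInner f g) :=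
  ContDiff.sum fun i _ => (hf.pd i).mul (hg.pd i)

theorem pd_mul {n : ℕ} {f g : EuclideanSpace ℝ (Fin n) → ℝ} (hf : ContDiff ℝ (⊤ : ℕ∞) f)
    (hg : ContDiff ℝ (⊤ : ℕ∞) g) (i : Fin n) :
    pd i (fun x => f x * g x) = fun x => f x * pd i g x + g x * pd i f x := by
  ext x
  have h1 : DifferentiableAt ℝ f x := (hf.differentiable (by simp)) x
  have h2 : DifferentiableAt ℝ g x := (hg.differentiable (by simp)) x
  simp [pd, fderiv_fun_mul h1 h2]

theorem pd_add {n : ℕ} {f g : EuclideanSpace ℝ (Fin n) → ℝ} (hf : ContDiff ℝ (⊤ : ℕ∞) f)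
    (hg : ContDiff ℝ (⊤ : ℕ∞) g) (i : Fin n) :
    pd i (fun x => f x + g x) = fun x => pd i f x + pd i g x := by
  ext x
  have h1 : DifferentiableAt ℝ f x := (hf.differentiable (by simp)) x
  have h2 : DifferentiableAt ℝ g x := (hg.differentiable (by simp)) x
  simp [pd, fderiv_fun_add h1 h2]

theorem lap_mul {n : ℕ} {f g : EuclideanSpace ℝ (Fin n) → ℝ} (hf : ContDiff ℝ (⊤ : ℕ∞) f)
    (hg : ContDiff ℝ (⊤ : ℕ∞) g) (x) :
    lap (fun x => f x * g x) x = f x * lap g x + g x * lap f x + 2 * gradInner f g x := by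
  simp only [lap_eq_sum_pd, gradInner, Finset.mul_sum, ← Finset.sum_add_distrib]
  refine Finset.sum_congr rfl fun i _ => ?_
  rw [pd_mul hf hg, pd_add (hf.mul (hg.pd i)) (hg.mul (hf.pd i)), pd_mul hf (hg.pd i),
    pd_mul hg (hf.pd i)]
  ring

theorem gradInner_mul_right {n : ℕ} {f g h : EuclideanSpace ℝ (Fin n) → ℝ}
    (hg : ContDiff ℝ (⊤ : ℕ∞) g) (hh : ContDiff ℝ (⊤ : ℕ∞) h) (x) :
    gradInner f (fun x => g x * h x) x = g x * gradInner f h x + h x * gradInner f g x := by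
  simp only [gradInner, pd_mul hg hh, Finset.mul_sum, ← Finset.sum_add_distrib]
  exact Finset.sum_congr rfl fun i _ => by ring

theorem gradInner_comm {n : ℕ} (f g : EuclideanSpace ℝ (Fin n) → ℝ) :
    gradInner f g = gradInner g f := by
  ext x; exact Finset.sum_congr rfl fun i _ => mul_comm _ _

theorem gradInner_self_nonneg {n : ℕ} (f : EuclideanSpace ℝ (Fin n) → ℝ) (x) :
    0 ≤ gradInner f f x := Finset.sum_nonneg fun _ _ => mul_self_nonneg _

theorem gradInner_sq_le {n : ℕ} (f g : EuclideanSpace ℝ (Fin n) → ℝ) (x) :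
    gradInner f g x ^ 2 ≤ gradInner f f x * gradInner g g x := by
  simpa only [gradInner, pow_two] using
    Finset.sum_mul_sq_le_sq_mul_sq Finset.univ (fun i => pd i f x) (fun i => pd i g x)

theorem hasCompactSupport_pd {n : ℕ} {f : EuclideanSpace ℝ (Fin n) → ℝ}
    (hf : HasCompactSupport f) (i : Fin n) : HasCompactSupport (pd i f) :=
  (hf.fderiv (𝕜 := ℝ)).comp_left
    (g := fun l : EuclideanSpace ℝ (Fin n) →L[ℝ] ℝ => l (EuclideanSpace.single i 1)) (by simp)

theorem integral_mul_pd {n : ℕ} {f g : EuclideanSpace ℝ (Fin n) → ℝ}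
    (hf : ContDiff ℝ (⊤ : ℕ∞) f) (hg : ContDiff ℝ (⊤ : ℕ∞) g) (hc : HasCompactSupport g)
    (i : Fin n) : ∫ x, f x * pd i g x = -∫ x, pd i f x * g x := by
  apply integral_mul_fderiv_eq_neg_fderiv_mul_of_integrable
  · exact ((hf.pd i).continuous.mul hg.continuous).integrable_of_hasCompactSupport hc.mul_left
  · exact (hf.continuous.mul (hg.pd i).continuous).integrable_of_hasCompactSupport
      (hasCompactSupport_pd hc i).mul_left
  · exact (hf.continuous.mul hg.continuous).integrable_of_hasCompactSupport hc.mul_left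
  · exact fun x _ => hf.differentiable (by simp) x
  · exact fun x _ => hg.differentiable (by simp) x

/-- Green's second identity against a compactly supported function. -/
theorem integral_mul_lap {n : ℕ} {f g : EuclideanSpace ℝ (Fin n) → ℝ}
    (hf : ContDiff ℝ (⊤ : ℕ∞) f) (hg : ContDiff ℝ (⊤ : ℕ∞) g) (hc : HasCompactSupport g) :
    ∫ x, f x * lap g x = ∫ x, lap f x * g x := by
  simp only [lap_eq_sum_pd, Finset.mul_sum, Finset.sum_mul]
  rw [integral_finsetSum, integral_finsetSum]
  · refine Finset.sum_congr rfl fun i _ => ?_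
    rw [integral_mul_pd hf (hg.pd i) (hasCompactSupport_pd hc i), integral_mul_pd (hf.pd i) hg hc, neg_neg]
  · exact fun i _ => (((hf.pd i).pd i).continuous.mul hg.continuous).integrable_of_hasCompactSupport
      hc.mul_left
  · exact fun i _ => (hf.continuous.mul ((hg.pd i).pd i).continuous).integrable_of_hasCompactSupport
      (hasCompactSupport_pd (hasCompactSupport_pd hc i) i).mul_left

theorem cutoff_quadratic_form_ge {a b c e F g l s : ℝ} (hs : 0 ≤ s) (he0 : 0 ≤ e) (he1 : e ≤ 1)
    (hg0 : 0 ≤ g) (hg : g ≤ s) (hl : |l| ≤ s) (hF : 0 ≤ F) (hc : c ^ 2 ≤ F * g) :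
    -(2300 * s ^ 2) * a ^ 2 ≤
      b * (e ^ 4 * b + a * (4 * e ^ 3 * l + 12 * e ^ 2 * g) + 8 * e ^ 3 * c) +
        32 * s * (2 * (e ^ 2 * F) + 2 * (e ^ 2 * a * b) - a ^ 2 * (2 * (e * l) + 2 * g)) := by
  have hcF : e ^ 2 * c ^ 2 ≤ e ^ 2 * (F * s) :=
    mul_le_mul_of_nonneg_left (hc.trans (mul_le_mul_of_nonneg_left hg hF)) (sq_nonneg e)
  have hel : |e * l| ≤ s := by
    rw [abs_mul, abs_of_nonneg he0]
    nlinarith [abs_nonneg l]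
  obtain ⟨hel1, hel2⟩ := abs_le.mp hel
  have hk : |4 * (e * l) + 12 * g + 64 * s| ≤ 80 * s := abs_le.mpr ⟨by linarith, by linarith⟩
  have hk2 : (4 * (e * l) + 12 * g + 64 * s) ^ 2 ≤ (80 * s) ^ 2 := sq_le_sq.mpr (by
    rwa [abs_of_nonneg (by positivity : 0 ≤ 80 * s)])
  have ha := mul_le_mul_of_nonneg_left hk2 (sq_nonneg a)
  have h3 : s * (a ^ 2 * (2 * (e * l) + 2 * g)) ≤ s * (a ^ 2 * (4 * s)) := by
    gcongr; linarith
  nlinarith [sq_nonneg (e ^ 2 * b / 2 + 8 * (e * c)),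
    sq_nonneg (3 * (e ^ 2 * b) + 2 * (a * (4 * (e * l) + 12 * g + 64 * s))),
    mul_nonneg (sq_nonneg a) (sq_nonneg s)]

/-- The local energy estimate behind the biharmonic heat flow, for a cutoff `η` with first and
second derivatives controlled by `s`. -/
theorem neg_integral_bilap_le {n : ℕ} {f η : EuclideanSpace ℝ (Fin n) → ℝ} {s r : ℝ} (hs : 0 ≤ s)
    (hf : ContDiff ℝ (⊤ : ℕ∞) f) (hη : ContDiff ℝ (⊤ : ℕ∞) η)
    (h0 : ∀ x, 0 ≤ η x) (h1 : ∀ x, η x ≤ 1)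
    (hsupp : ∀ x ∉ closedBall (0 : EuclideanSpace ℝ (Fin n)) r, η x = 0 ∧ gradInner η η x = 0)
    (hgrad : ∀ x, gradInner η η x ≤ s) (hlap : ∀ x, |lap η x| ≤ s) :
    -∫ x, lap (lap f) x * (f x * η x ^ 4) ≤
      2300 * s ^ 2 * ∫ x in closedBall (0 : EuclideanSpace ℝ (Fin n)) r, f x ^ 2 := by
  have hcη : HasCompactSupport η := HasCompactSupport.intro (isCompact_closedBall 0 r)
    fun x hx => (hsupp x hx).1
  have hη2 : ContDiff ℝ (⊤ : ℕ∞) (fun x => η x * η x) := hη.mul hη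
  have hη4 : ContDiff ℝ (⊤ : ℕ∞) (fun x => (η x * η x) * (η x * η x)) := hη2.mul hη2
  have hcη2 : HasCompactSupport (fun x => η x * η x) := hcη.mul_left
  have hcη4 : HasCompactSupport (fun x => (η x * η x) * (η x * η x)) := hcη2.mul_left
  have el2 : ∀ x, lap (fun x => η x * η x) x = 2 * (η x * lap η x) + 2 * gradInner η η x :=
    fun x => by rw [lap_mul hη hη]; ring
  have eg2 : ∀ x, gradInner (fun x => η x * η x) (fun x => η x * η x) x =
      4 * η x ^ 2 * gradInner η η x := fun x => by
    rw [gradInner_mul_right hη hη, gradInner_comm _ η, gradInner_mul_right hη hη]; ring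
  have el4 : ∀ x, lap (fun x => (η x * η x) * (η x * η x)) x =
      4 * η x ^ 3 * lap η x + 12 * η x ^ 2 * gradInner η η x := fun x => by
    rw [lap_mul hη2 hη2, el2, eg2]; ring
  have eg4 : ∀ x, gradInner f (fun x => (η x * η x) * (η x * η x)) x =
      4 * η x ^ 3 * gradInner f η x := fun x => by
    rw [gradInner_mul_right hη2 hη2, gradInner_mul_right hη hη]; ring
  have hI : ∫ x, lap (lap f) x * (f x * η x ^ 4) = ∫ x, lap f x *
      (η x ^ 4 * lap f x + f x * (4 * η x ^ 3 * lap η x + 12 * η x ^ 2 * gradInner η η x) +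
        8 * η x ^ 3 * gradInner f η x) := by
    have := integral_mul_lap hf.lap (hf.mul hη4) hcη4.mul_left
    calc _ = ∫ x, lap (lap f) x * (f x * ((η x * η x) * (η x * η x))) := by
          congr 1; ext x; ring
      _ = _ := by
          rw [← this]; congr 1; ext x
          rw [lap_mul hf hη4, el4, eg4]; ring
  have hG : ∫ x, f x ^ 2 * (2 * (η x * lap η x) + 2 * gradInner η η x) =
      ∫ x, 2 * (η x ^ 2 * gradInner f f x) + 2 * (η x ^ 2 * f x * lap f x) := by
    have := integral_mul_lap (hf.mul hf) hη2 hcη2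
    calc _ = ∫ x, f x * f x * lap (fun x => η x * η x) x := by
          congr 1; ext x; rw [el2]; ring
      _ = _ := by
          rw [this]; congr 1; ext x; rw [lap_mul hf hf]; ring
  set I : EuclideanSpace ℝ (Fin n) → ℝ := fun x => lap f x *
      (η x ^ 4 * lap f x + f x * (4 * η x ^ 3 * lap η x + 12 * η x ^ 2 * gradInner η η x) +
        8 * η x ^ 3 * gradInner f η x) with hIdef
  set P : EuclideanSpace ℝ (Fin n) → ℝ := fun x =>
    2 * (η x ^ 2 * gradInner f f x) + 2 * (η x ^ 2 * f x * lap f x) with hP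
  set Q : EuclideanSpace ℝ (Fin n) → ℝ := fun x =>
    f x ^ 2 * (2 * (η x * lap η x) + 2 * gradInner η η x) with hQ
  have hfc := hf.continuous
  have hηc := hη.continuous
  have hlf := hf.lap.continuous
  have hlη := hη.lap.continuous
  have hgff := (hf.gradInner hf).continuous
  have hgfη := (hf.gradInner hη).continuous
  have hgηη := (hη.gradInner hη).continuous
  have hcpt : ∀ F : EuclideanSpace ℝ (Fin n) → ℝ, Continuous F →
      (∀ x, η x = 0 → gradInner η η x = 0 → F x = 0) → Integrable F := fun F hF h =>
    hF.integrable_of_hasCompactSupport (HasCompactSupport.intro (isCompact_closedBall 0 r)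
      fun x hx => h x (hsupp x hx).1 (hsupp x hx).2)
  have hIi : Integrable I := hcpt I (by fun_prop) fun x h h' => by simp [hIdef, h]
  have hPi : Integrable P := hcpt P (by fun_prop) fun x h h' => by simp [hP, h]
  have hQi : Integrable Q := hcpt Q (by fun_prop) fun x h h' => by simp [hQ, h, h']
  have hpt : ∀ x, -(2300 * s ^ 2) *
      (closedBall (0 : EuclideanSpace ℝ (Fin n)) r).indicator (fun x => f x ^ 2) x ≤
      I x + 32 * s * (P x - Q x) := by
    intro x
    by_cases hx : x ∈ closedBall (0 : EuclideanSpace ℝ (Fin n)) r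
    · rw [indicator_of_mem hx]
      have hg := hgrad x
      have hl := hlap x
      have hgn := gradInner_self_nonneg η x
      have hcs := gradInner_sq_le f η x
      have hffn := gradInner_self_nonneg f x
      have hη0 := h0 x
      have hη1 := h1 x
      simp only [hIdef, hP, hQ]
      exact cutoff_quadratic_form_ge hs hη0 hη1 hgn hg hl hffn hcs
    · obtain ⟨e0, e1⟩ := hsupp x hx
      rw [indicator_of_notMem hx]
      simp [hIdef, hP, hQ, e0, e1]
  have hball : Integrable ((closedBall (0 : EuclideanSpace ℝ (Fin n)) r).indicator
      (fun x => f x ^ 2)) :=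
    (((hfc.pow 2).continuousOn).integrableOn_compact (isCompact_closedBall 0 r)).integrable_indicator
      measurableSet_closedBall
  have hPQ : Integrable (fun x => 32 * s * (P x - Q x)) := (hPi.sub hQi).const_mul _
  have hfin : ∫ x, -(2300 * s ^ 2) *
      (closedBall (0 : EuclideanSpace ℝ (Fin n)) r).indicator (fun x => f x ^ 2) x ≤
      ∫ x, (I x + 32 * s * (P x - Q x)) :=
    integral_mono (hball.const_mul _) (hIi.add hPQ) hpt
  rw [integral_const_mul, integral_indicator measurableSet_closedBall,
    integral_add hIi hPQ, integral_const_mul,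
    integral_sub hPi hQi, hG, sub_self, mul_zero, add_zero] at hfin
  rw [hI]
  linarith

theorem exists_contDiff_step : ∃ (φ : ℝ → ℝ) (M : ℝ), ContDiff ℝ (⊤ : ℕ∞) φ ∧ 0 ≤ M ∧
    (∀ s, 0 ≤ φ s) ∧ (∀ s, φ s ≤ 1) ∧ (∀ s ≤ 0, φ s = 1) ∧
    (∀ s, 1 < s → φ s = 0 ∧ deriv φ s = 0 ∧ deriv (deriv φ) s = 0) ∧
    (∀ s, |deriv φ s| ≤ M) ∧ (∀ s, |deriv (deriv φ) s| ≤ M) := by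
  set φ : ℝ → ℝ := fun s => Real.smoothTransition (1 - s) with hφ
  have hc : ContDiff ℝ (⊤ : ℕ∞) φ := Real.smoothTransition.contDiff.comp (by fun_prop)
  have hc1 : ContDiff ℝ (⊤ : ℕ∞) (deriv φ) := (contDiff_infty_iff_deriv.mp hc).2
  have hc2 : ContDiff ℝ (⊤ : ℕ∞) (deriv (deriv φ)) := (contDiff_infty_iff_deriv.mp hc1).2
  have e1 : ∀ s, 1 < s → φ =ᶠ[nhds s] fun _ => 0 := fun s hs =>
    (eventually_gt_nhds hs).mono fun y hy =>
      Real.smoothTransition.zero_of_nonpos (by linarith)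
  have e0 : ∀ s, s < 0 → φ =ᶠ[nhds s] fun _ => 1 := fun s hs =>
    (eventually_lt_nhds hs).mono fun y hy =>
      Real.smoothTransition.one_of_one_le (by linarith)
  have hloc : ∀ (s k : ℝ), φ =ᶠ[nhds s] (fun _ => k) →
      deriv φ s = 0 ∧ deriv (deriv φ) s = 0 := by
    intro s k h
    have h1 := h.deriv
    have h2 := h1.deriv
    exact ⟨by simpa using h1.eq_of_nhds, by simpa using h2.eq_of_nhds⟩
  have hout : ∀ s ∉ Icc (0 : ℝ) 1, deriv φ s = 0 ∧ deriv (deriv φ) s = 0 := by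
    intro s hs
    rcases lt_or_ge s 0 with h | h
    · exact hloc s 1 (e0 s h)
    · exact hloc s 0 (e1 s (not_le.mp fun h' => hs ⟨h, h'⟩))
  obtain ⟨M₁, h₁⟩ := hc1.continuous.bounded_above_of_compact_support
    (HasCompactSupport.intro isCompact_Icc fun s hs => (hout s hs).1)
  obtain ⟨M₂, h₂⟩ := hc2.continuous.bounded_above_of_compact_support
    (HasCompactSupport.intro isCompact_Icc fun s hs => (hout s hs).2)
  refine ⟨φ, max M₁ M₂, hc, ((norm_nonneg _).trans (h₁ 0)).trans (le_max_left _ _),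
    fun s => Real.smoothTransition.nonneg _, fun s => Real.smoothTransition.le_one _,
    fun s hs => Real.smoothTransition.one_of_one_le (by linarith),
    fun s hs => ⟨(e1 s hs).eq_of_nhds, hloc s 0 (e1 s hs)⟩,
    fun s => (h₁ s).trans (le_max_left _ _), fun s => (h₂ s).trans (le_max_right _ _)⟩

theorem pd_comp_norm_sq {n : ℕ} {φ : ℝ → ℝ} (hφ : Differentiable ℝ φ) (ρ D : ℝ) (i : Fin n) :
    pd i (fun x => φ ((‖x‖ ^ 2 - ρ ^ 2) / D)) =
      fun x => deriv φ ((‖x‖ ^ 2 - ρ ^ 2) / D) * (2 * x i / D) := by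
  ext x
  have h1 : HasFDerivAt (fun y : EuclideanSpace ℝ (Fin n) => (‖y‖ ^ 2 - ρ ^ 2) / D)
      (D⁻¹ • (2 • innerSL ℝ x)) x := by
    simpa only [div_eq_inv_mul] using
      (((hasStrictFDerivAt_norm_sq x).hasFDerivAt).sub_const (ρ ^ 2)).const_mul D⁻¹
  have h2 := (hφ ((‖x‖ ^ 2 - ρ ^ 2) / D)).hasDerivAt.comp_hasFDerivAt x h1
  have h3 := h2.fderiv
  simp only [pd]
  change fderiv ℝ (φ ∘ fun y : EuclideanSpace ℝ (Fin n) => (‖y‖ ^ 2 - ρ ^ 2) / D) x _ = _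
  rw [h3]
  simp [EuclideanSpace.inner_single_right, div_eq_mul_inv]
  exact Or.inl (by ring)

theorem exists_cutoff (n : ℕ) : ∃ A : ℝ, 0 < A ∧ ∀ ρ r : ℝ, 0 < ρ → ρ < r →
    ∃ η : EuclideanSpace ℝ (Fin n) → ℝ, ContDiff ℝ (⊤ : ℕ∞) η ∧ (∀ x, 0 ≤ η x) ∧
      (∀ x, η x ≤ 1) ∧ (∀ x ∈ closedBall (0 : EuclideanSpace ℝ (Fin n)) ρ, η x = 1) ∧
      (∀ x ∉ closedBall (0 : EuclideanSpace ℝ (Fin n)) r, η x = 0 ∧ gradInner η η x = 0) ∧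
      (∀ x, gradInner η η x ≤ A / (r - ρ) ^ 2) ∧ (∀ x, |lap η x| ≤ A / (r - ρ) ^ 2) := by
  obtain ⟨φ, M, hφ, hM, h0, h1, hone, hzero, hM1, hM2⟩ := exists_contDiff_step
  have hφ1 : ContDiff ℝ (⊤ : ℕ∞) (deriv φ) := (contDiff_infty_iff_deriv.mp hφ).2
  refine ⟨4 * M ^ 2 + 4 * M + 2 * n * M + 1, by positivity, fun ρ r hρ hr => ?_⟩
  have hd : 0 < r - ρ := sub_pos.mpr hr
  set D : ℝ := r ^ 2 - ρ ^ 2 with hD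
  have hDr : (r - ρ) * r ≤ D := by nlinarith
  have hDd : (r - ρ) ^ 2 ≤ D := by nlinarith
  have hDpos : 0 < D := by nlinarith
  set ψ : EuclideanSpace ℝ (Fin n) → ℝ := fun x => (‖x‖ ^ 2 - ρ ^ 2) / D with hψ
  have hpd : ∀ i, pd i (fun x => φ (ψ x)) = fun x => deriv φ (ψ x) * (2 * x i / D) := fun i =>
    pd_comp_norm_sq (hφ.differentiable (by simp)) ρ D i
  have hpd2 : ∀ i x, pd i (pd i (fun x => φ (ψ x))) x =
      deriv (deriv φ) (ψ x) * (2 * x i / D) ^ 2 + deriv φ (ψ x) * (2 / D) := by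
    intro i x
    have hx : ContDiff ℝ (⊤ : ℕ∞) fun x : EuclideanSpace ℝ (Fin n) => 2 * x i / D := by fun_prop
    have hψc : ContDiff ℝ (⊤ : ℕ∞) ψ := ((contDiff_norm_sq ℝ).sub contDiff_const).div_const D
    have hxi : pd i (fun x : EuclideanSpace ℝ (Fin n) => 2 * x i / D) x = 2 / D := by
      have : HasFDerivAt (fun x : EuclideanSpace ℝ (Fin n) => 2 * x i / D)
          ((2 / D) • (EuclideanSpace.proj i : EuclideanSpace ℝ (Fin n) →L[ℝ] ℝ)) x := by
        have := (((EuclideanSpace.proj i : EuclideanSpace ℝ (Fin n) →L[ℝ] ℝ)).hasFDerivAt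
          (x := x)).const_mul (2 / D)
        refine this.congr_of_eventuallyEq (Eventually.of_forall fun y => ?_)
        simp [mul_div_right_comm]
      simp [pd, this.fderiv]
    rw [hpd, pd_mul (f := fun x => deriv φ (ψ x)) (hφ1.comp hψc) hx]
    beta_reduce
    rw [hxi, show pd i (fun x => deriv φ (ψ x)) = _ from
        pd_comp_norm_sq (hφ1.differentiable (by simp)) ρ D i]
    ring
  have hsum : ∀ x : EuclideanSpace ℝ (Fin n), ∑ i, (2 * x i / D) ^ 2 = 4 * ‖x‖ ^ 2 / D ^ 2 := by
    intro x
    rw [EuclideanSpace.real_norm_sq_eq, Finset.mul_sum, Finset.sum_div]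
    exact Finset.sum_congr rfl fun i _ => by ring_nf
  have hgr : ∀ x, gradInner (fun x => φ (ψ x)) (fun x => φ (ψ x)) x =
      deriv φ (ψ x) ^ 2 * (4 * ‖x‖ ^ 2 / D ^ 2) := by
    intro x
    simp only [gradInner, hpd]
    rw [← hsum, Finset.mul_sum]
    exact Finset.sum_congr rfl fun i _ => by ring
  have hla : ∀ x, lap (fun x => φ (ψ x)) x =
      deriv (deriv φ) (ψ x) * (4 * ‖x‖ ^ 2 / D ^ 2) + deriv φ (ψ x) * (2 * n / D) := by
    intro x
    rw [lap_eq_sum_pd, Finset.sum_congr rfl fun i _ => hpd2 i x, Finset.sum_add_distrib,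
      ← Finset.mul_sum, hsum, Finset.sum_const, Finset.card_univ, Fintype.card_fin, nsmul_eq_mul]
    ring
  have hbig : ∀ x ∉ closedBall (0 : EuclideanSpace ℝ (Fin n)) r, 1 < ψ x := by
    intro x hx
    rw [mem_closedBall_zero_iff, not_le] at hx
    rw [hψ, lt_div_iff₀ hDpos]
    nlinarith
  have hin : ∀ x ∈ closedBall (0 : EuclideanSpace ℝ (Fin n)) r,
      4 * ‖x‖ ^ 2 / D ^ 2 ≤ 4 / (r - ρ) ^ 2 := by
    intro x hx
    rw [mem_closedBall_zero_iff] at hx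
    rw [div_le_div_iff₀ (by positivity) (by positivity)]
    have : ‖x‖ * (r - ρ) ≤ D := le_trans (by nlinarith) hDr
    have := pow_le_pow_left₀ (by positivity) this 2
    nlinarith
  have hn : 2 * n / D ≤ 2 * n / (r - ρ) ^ 2 := by gcongr
  refine ⟨fun x => φ (ψ x), hφ.comp (((contDiff_norm_sq ℝ).sub contDiff_const).div_const D),
    fun x => h0 _, fun x => h1 _, fun x hx => hone _ ?_, fun x hx => ⟨(hzero _ (hbig x hx)).1, ?_⟩,
    fun x => ?_, fun x => ?_⟩
  · rw [mem_closedBall_zero_iff] at hx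
    refine div_nonpos_of_nonpos_of_nonneg ?_ hDpos.le
    nlinarith [norm_nonneg x]
  · rw [hgr, (hzero _ (hbig x hx)).2.1]; ring
  · rw [hgr]
    by_cases hx : x ∈ closedBall (0 : EuclideanSpace ℝ (Fin n)) r
    · calc _ ≤ M ^ 2 * (4 / (r - ρ) ^ 2) := by
            refine mul_le_mul ?_ (hin x hx) (by positivity) (by positivity)
            exact sq_le_sq.mpr (by rw [abs_of_nonneg hM]; exact hM1 _)
        _ = 4 * M ^ 2 / (r - ρ) ^ 2 := by ring
        _ ≤ _ := div_le_div_of_nonneg_right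
            (by nlinarith [mul_nonneg (Nat.cast_nonneg (α := ℝ) n) hM]) (by positivity)
    · rw [(hzero _ (hbig x hx)).2.1, zero_pow two_ne_zero, zero_mul]; positivity
  · rw [hla]
    by_cases hx : x ∈ closedBall (0 : EuclideanSpace ℝ (Fin n)) r
    · calc _ ≤ |deriv (deriv φ) (ψ x)| * (4 * ‖x‖ ^ 2 / D ^ 2) + |deriv φ (ψ x)| * (2 * n / D) := by
            refine (abs_add_le _ _).trans (le_of_eq ?_)
            rw [abs_mul, abs_mul, abs_of_nonneg (by positivity : 0 ≤ 4 * ‖x‖ ^ 2 / D ^ 2),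
              abs_of_nonneg (by positivity : 0 ≤ 2 * (n : ℝ) / D)]
        _ ≤ M * (4 / (r - ρ) ^ 2) + M * (2 * n / (r - ρ) ^ 2) :=
            add_le_add (mul_le_mul (hM2 _) (hin x hx) (by positivity) hM)
              (mul_le_mul (hM1 _) hn (by positivity) hM)
        _ = (4 * M + 2 * n * M) / (r - ρ) ^ 2 := by ring
        _ ≤ _ := div_le_div_of_nonneg_right (by nlinarith [sq_nonneg M]) (by positivity)
    · obtain ⟨-, z1, z2⟩ := hzero _ (hbig x hx)
      rw [z1, z2, zero_mul, zero_mul, add_zero, abs_zero]; positivity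

theorem continuousOn_setIntegral_of_isCompact {X : Type*} [TopologicalSpace X] [MeasurableSpace X]
    [OpensMeasurableSpace X] {μ : Measure X} [IsLocallyFiniteMeasure μ] {w : X → ℝ → ℝ} {S : Set ℝ}
    (hS : IsLocallyClosed S) (hw : ContinuousOn (fun p : X × ℝ => w p.1 p.2) {p | p.2 ∈ S})
    {K : Set X} (hK : IsCompact K) : ContinuousOn (fun t => ∫ x in K, w x t ∂μ) S := by
  rw [continuousOn_iff_continuous_domRestrict]
  have : LocallyCompactSpace S := hS.locallyCompactSpace
  refine continuous_parametric_integral_of_continuous (f := fun (t : S) x => w x t) ?_ hK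
  exact hw.comp_continuous (f := fun q : S × X => (q.2, (q.1 : ℝ))) (by fun_prop)
    fun q => q.1.2

theorem IsBiharmonicHeatSol.contDiff_slice {n : ℕ} {T : ℝ} {u : EuclideanSpace ℝ (Fin n) → ℝ → ℝ}
    (hu : IsBiharmonicHeatSol u {p | p.2 ∈ Ioc 0 T}) {t : ℝ} (ht : t ∈ Ioc 0 T) :
    ContDiff ℝ (⊤ : ℕ∞) fun x => u x t :=
  contDiffOn_univ.mp <| hu.1.comp (g := fun p : EuclideanSpace ℝ (Fin n) × ℝ => u p.1 p.2)
    (f := fun x => (x, t)) (by fun_prop) fun x _ => ht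

theorem IsBiharmonicHeatSol.hasDerivAt {n : ℕ} {T : ℝ} {u : EuclideanSpace ℝ (Fin n) → ℝ → ℝ}
    (hu : IsBiharmonicHeatSol u {p | p.2 ∈ Ioc 0 T}) {t : ℝ} (ht : t ∈ Ioo 0 T)
    (x : EuclideanSpace ℝ (Fin n)) :
    HasDerivAt (fun s => u x s) (-(lap (lap (fun y => u y t)) x)) t :=
  (hu.2 (x, t) (Ioo_subset_Ioc_self ht)).hasDerivAt (Ioc_mem_nhds ht.1 ht.2)

theorem IsBiharmonicHeatSol.continuousOn_bilap {n : ℕ} {T : ℝ}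
    {u : EuclideanSpace ℝ (Fin n) → ℝ → ℝ} (hu : IsBiharmonicHeatSol u {p | p.2 ∈ Ioc 0 T}) :
    ContinuousOn (fun p : EuclideanSpace ℝ (Fin n) × ℝ => lap (lap (fun y => u y p.2)) p.1)
      {p | p.2 ∈ Ioo 0 T} := by
  set O : Set (EuclideanSpace ℝ (Fin n) × ℝ) := {p | p.2 ∈ Ioo 0 T}
  have hO : IsOpen O := isOpen_Ioo.preimage continuous_snd
  have hU : ContDiffOn ℝ (⊤ : ℕ∞) (fun p : EuclideanSpace ℝ (Fin n) × ℝ => u p.1 p.2) O :=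
    hu.1.mono fun p hp => Ioo_subset_Ioc_self hp
  have hc : ContinuousOn (fun p => -(fderiv ℝ (fun p : EuclideanSpace ℝ (Fin n) × ℝ => u p.1 p.2) p
      (0, 1))) O :=
    ((hU.continuousOn_fderiv_of_isOpen hO (by simp)).clm_apply continuousOn_const).neg
  refine hc.congr fun p hp => ?_
  have h1 := (hU.differentiableOn (by simp)).differentiableAt (hO.mem_nhds hp)
  have h2 : HasDerivAt (fun s : ℝ => (p.1, s)) ((0 : EuclideanSpace ℝ (Fin n)), (1 : ℝ)) p.2 :=
    (hasDerivAt_const _ _).prodMk (hasDerivAt_id _)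
  have h3 := h1.hasFDerivAt.comp_hasDerivAt p.2 h2
  exact neg_eq_iff_eq_neg.mp ((hu.hasDerivAt hp p.1).unique h3)

theorem IsBiharmonicHeatSol.hasDerivAt_energy {n : ℕ} {T : ℝ}
    {u : EuclideanSpace ℝ (Fin n) → ℝ → ℝ} (hu : IsBiharmonicHeatSol u {p | p.2 ∈ Ioc 0 T})
    {ζ : EuclideanSpace ℝ (Fin n) → ℝ} (hζ : Continuous ζ) {K : Set (EuclideanSpace ℝ (Fin n))}
    (hK : IsCompact K) {t : ℝ} (ht : t ∈ Ioo 0 T) :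
    HasDerivAt (fun s => ∫ x in K, u x s ^ 2 * ζ x)
      (∫ x in K, -2 * (lap (lap (fun y => u y t)) x * (u x t * ζ x))) t := by
  obtain ⟨α, hα0, hαt⟩ := exists_between ht.1
  obtain ⟨β, htβ, hβT⟩ := exists_between ht.2
  have hcu : ContinuousOn (fun p : EuclideanSpace ℝ (Fin n) × ℝ => u p.1 p.2)
      {p | p.2 ∈ Ioo 0 T} := hu.1.continuousOn.mono fun p hp => Ioo_subset_Ioc_self hp
  have hζ' : ContinuousOn (fun p : EuclideanSpace ℝ (Fin n) × ℝ => ζ p.1) {p | p.2 ∈ Ioo 0 T} :=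
    (hζ.comp continuous_fst).continuousOn
  have hF' : ContinuousOn (fun p : EuclideanSpace ℝ (Fin n) × ℝ =>
      -2 * (lap (lap (fun y => u y p.2)) p.1 * (u p.1 p.2 * ζ p.1))) {p | p.2 ∈ Ioo 0 T} :=
    continuousOn_const.mul (hu.continuousOn_bilap.mul (hcu.mul hζ'))
  have hsl : ∀ s ∈ Ioo 0 T, Continuous fun x => u x s := fun s hs =>
    (hu.contDiff_slice (Ioo_subset_Ioc_self hs)).continuous
  obtain ⟨M, hM⟩ := (hK.prod (isCompact_Icc (a := α) (b := β))).exists_bound_of_continuousOn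
    (hF'.mono fun p hp => ⟨hα0.trans_le hp.2.1, hp.2.2.trans_lt hβT⟩)
  have : IsFiniteMeasure (volume.restrict K) := ⟨by simpa using hK.measure_lt_top⟩
  refine (hasDerivAt_integral_of_dominated_loc_of_deriv_le (bound := fun _ => M)
    (F := fun s x => u x s ^ 2 * ζ x)
    (F' := fun s x => -2 * (lap (lap (fun y => u y s)) x * (u x s * ζ x)))
    (Icc_mem_nhds hαt htβ) ?_ ?_ ?_ ?_ (integrable_const M) ?_).2
  · filter_upwards [Ioo_mem_nhds ht.1 ht.2] with s hs
    exact (((hsl s hs).pow 2).mul hζ).aestronglyMeasurable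
  · exact (((hsl t ht).pow 2).mul hζ).continuousOn.integrableOn_compact hK
  · refine Continuous.aestronglyMeasurable ?_
    exact continuous_const.mul ((hu.contDiff_slice
      (Ioo_subset_Ioc_self ht)).lap.lap.continuous.mul ((hsl t ht).mul hζ))
  · refine (ae_restrict_mem hK.measurableSet).mono fun x hx s hs => hM (x, s) ⟨hx, hs⟩
  · refine Eventually.of_forall fun x s hs => ?_
    have := ((hu.hasDerivAt ⟨hα0.trans_le hs.1, hs.2.trans_lt hβT⟩ x).pow 2).mul_const (ζ x)
    refine this.congr_deriv ?_
    simp; ring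

/-- The local energy inequality: the energy on a ball at a later time is controlled by the energy on
a larger ball at an earlier time plus the accumulated energy in between. -/
theorem IsBiharmonicHeatSol.energy_le {n : ℕ} {T : ℝ} {u : EuclideanSpace ℝ (Fin n) → ℝ → ℝ}
    (hu : IsBiharmonicHeatSol u {p | p.2 ∈ Ioc 0 T}) :
    ∃ C : ℝ, 0 < C ∧ ∀ ρ r τ t, 0 < ρ → ρ < r → 0 < τ → τ ≤ t → t < T →
      ∫ x in closedBall (0 : EuclideanSpace ℝ (Fin n)) ρ, u x t ^ 2 ≤
        (∫ x in closedBall (0 : EuclideanSpace ℝ (Fin n)) r, u x τ ^ 2) +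
          C / (r - ρ) ^ 4 *
            ∫ s in τ..t, ∫ x in closedBall (0 : EuclideanSpace ℝ (Fin n)) r, u x s ^ 2 := by
  obtain ⟨A, hA, hcut⟩ := exists_cutoff n
  refine ⟨4600 * A ^ 2, by positivity, fun ρ r τ t hρ hr hτ hτt htT => ?_⟩
  obtain ⟨η, hη, h0, h1, hone, hsupp, hgrad, hlap⟩ := hcut ρ r hρ hr
  have hKr := isCompact_closedBall (0 : EuclideanSpace ℝ (Fin n)) r
  have hd : 0 < r - ρ := sub_pos.mpr hr
  have hIcc : ∀ s ∈ Icc τ t, s ∈ Ioo 0 T := fun s hs => ⟨hτ.trans_le hs.1, hs.2.trans_lt htT⟩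
  have hsl : ∀ s ∈ Icc τ t, Continuous fun x => u x s := fun s hs =>
    (hu.contDiff_slice (Ioo_subset_Ioc_self (hIcc s hs))).continuous
  have hη4 : Continuous fun x => η x ^ 4 := hη.continuous.pow 4
  have hder : ∀ s ∈ Icc τ t, HasDerivAt
      (fun s => ∫ x in closedBall (0 : EuclideanSpace ℝ (Fin n)) r, u x s ^ 2 * η x ^ 4) _ s :=
    fun s hs => hu.hasDerivAt_energy hη4 hKr (hIcc s hs)
  have hE : ContinuousOn
      (fun s => ∫ x in closedBall (0 : EuclideanSpace ℝ (Fin n)) r, u x s ^ 2) (Icc τ t) :=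
    continuousOn_setIntegral_of_isCompact isClosed_Icc.isLocallyClosed ((hu.1.continuousOn.mono
      fun p hp => Ioo_subset_Ioc_self (hIcc p.2 hp)).pow 2) hKr
  have key := intervalIntegral.sub_le_integral_of_hasDeriv_right_of_le hτt
    (fun s hs => (hder s hs).continuousAt.continuousWithinAt)
    (fun s hs => (hder s (Ioo_subset_Icc_self hs)).hasDerivWithinAt)
    (φ := fun s => 4600 * A ^ 2 / (r - ρ) ^ 4 *
      ∫ x in closedBall (0 : EuclideanSpace ℝ (Fin n)) r, u x s ^ 2)
    (hE.const_mul _).integrableOn_Icc ?_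
  · rw [intervalIntegral.integral_const_mul] at key
    have hlow : ∫ x in closedBall (0 : EuclideanSpace ℝ (Fin n)) ρ, u x t ^ 2 ≤
        ∫ x in closedBall (0 : EuclideanSpace ℝ (Fin n)) r, u x t ^ 2 * η x ^ 4 := by
      have hc : Continuous fun x => u x t ^ 2 * η x ^ 4 :=
        ((hsl t (right_mem_Icc.mpr hτt)).pow 2).mul hη4
      calc _ = ∫ x in closedBall (0 : EuclideanSpace ℝ (Fin n)) ρ, u x t ^ 2 * η x ^ 4 :=
            setIntegral_congr_fun measurableSet_closedBall fun x hx => by simp [hone x hx]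
        _ ≤ _ := setIntegral_mono_set (hc.continuousOn.integrableOn_compact hKr)
            (Eventually.of_forall fun x => by positivity)
            (closedBall_subset_closedBall hr.le).eventuallyLE
    have hup : ∫ x in closedBall (0 : EuclideanSpace ℝ (Fin n)) r, u x τ ^ 2 * η x ^ 4 ≤
        ∫ x in closedBall (0 : EuclideanSpace ℝ (Fin n)) r, u x τ ^ 2 := by
      have hc : Continuous fun x => u x τ ^ 2 := (hsl τ (left_mem_Icc.mpr hτt)).pow 2
      refine setIntegral_mono ((hc.mul hη4).continuousOn.integrableOn_compact hKr)
        (hc.continuousOn.integrableOn_compact hKr) fun x => ?_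
      exact mul_le_of_le_one_right (sq_nonneg _) (pow_le_one₀ (h0 x) (h1 x))
    linarith
  · intro s hs
    have hf := hu.contDiff_slice (Ioo_subset_Ioc_self (hIcc s (Ioo_subset_Icc_self hs)))
    have h := neg_integral_bilap_le (by positivity) hf hη h0 h1 hsupp hgrad hlap
    rw [setIntegral_eq_integral_of_forall_compl_eq_zero fun x hx => by simp [(hsupp x hx).1],
      integral_const_mul]
    refine (by linarith : _ ≤ 2 * (2300 * (A / (r - ρ) ^ 2) ^ 2 *
      ∫ x in closedBall (0 : EuclideanSpace ℝ (Fin n)) r, u x s ^ 2)).trans (le_of_eq ?_)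
    rw [div_pow]
    ring

/-- The energy `∫_{|x| ≤ r} u(x,t)² dx`, extended by `0` to `t ≤ 0` and frozen for `t ≥ T`. -/
noncomputable def localEnergy {n : ℕ} (u : EuclideanSpace ℝ (Fin n) → ℝ → ℝ) (T t r : ℝ) : ℝ :=
  if t ≤ 0 then 0 else ∫ x in closedBall (0 : EuclideanSpace ℝ (Fin n)) r, u x (min t T) ^ 2

theorem localEnergy_of_nonpos {n : ℕ} (u : EuclideanSpace ℝ (Fin n) → ℝ → ℝ) (T : ℝ) {t : ℝ}
    (ht : t ≤ 0) (r : ℝ) : localEnergy u T t r = 0 := if_pos ht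

theorem localEnergy_of_mem {n : ℕ} (u : EuclideanSpace ℝ (Fin n) → ℝ → ℝ) {T t : ℝ}
    (ht : t ∈ Ioc 0 T) (r : ℝ) : localEnergy u T t r =
      ∫ x in closedBall (0 : EuclideanSpace ℝ (Fin n)) r, u x t ^ 2 := by
  rw [localEnergy, if_neg ht.1.not_ge, min_eq_left ht.2]

theorem localEnergy_nonneg {n : ℕ} (u : EuclideanSpace ℝ (Fin n) → ℝ → ℝ) (T t r : ℝ) :
    0 ≤ localEnergy u T t r := by
  unfold localEnergy
  split_ifs
  · exact le_rfl
  · exact integral_nonneg fun x => sq_nonneg _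

namespace IsBiharmonicHeatSol

variable {n : ℕ} {T : ℝ} {u : EuclideanSpace ℝ (Fin n) → ℝ → ℝ}

theorem monotone_localEnergy (hu : IsBiharmonicHeatSol u {p | p.2 ∈ Ioc 0 T}) (hT : 0 < T)
    (t : ℝ) : Monotone (localEnergy u T t) := by
  intro r r' h
  rcases le_or_gt t 0 with ht | ht
  · rw [localEnergy_of_nonpos u T ht, localEnergy_of_nonpos u T ht]
  · rw [localEnergy, localEnergy, if_neg ht.not_ge, if_neg ht.not_ge]
    have hc : Continuous fun x => u x (min t T) :=
      (hu.contDiff_slice ⟨lt_min ht hT, min_le_right _ _⟩).continuous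
    exact setIntegral_mono_set
      ((hc.pow 2).continuousOn.integrableOn_compact (isCompact_closedBall 0 r'))
      (Eventually.of_forall fun x => sq_nonneg _) (closedBall_subset_closedBall h).eventuallyLE

theorem continuous_localEnergy (hu : IsBiharmonicHeatSol u {p | p.2 ∈ Ioc 0 T}) (hT : 0 < T)
    (hinit : ∀ Ω : Set (EuclideanSpace ℝ (Fin n)), IsCompact Ω →
      Tendsto (fun t => ∫ x in Ω, (u x t) ^ 2) (nhdsWithin 0 (Ioi 0)) (nhds 0)) (r : ℝ) :
    Continuous fun t => localEnergy u T t r := by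
  have hK := isCompact_closedBall (0 : EuclideanSpace ℝ (Fin n)) r
  have hE : ContinuousOn
      (fun s => ∫ x in closedBall (0 : EuclideanSpace ℝ (Fin n)) r, u x s ^ 2) (Ioc 0 T) :=
    continuousOn_setIntegral_of_isCompact isLocallyClosed_Ioc (hu.1.continuousOn.pow 2) hK
  rw [continuous_iff_continuousAt]
  intro t
  rcases lt_trichotomy t 0 with ht | rfl | ht
  · exact (continuousAt_const (y := (0 : ℝ))).congr
      ((eventually_lt_nhds ht).mono fun s hs => (localEnergy_of_nonpos u T hs.le r).symm)
  · rw [ContinuousAt, localEnergy_of_nonpos u T le_rfl]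
    nth_rewrite 1 [← nhdsLE_sup_nhdsGT]
    refine Tendsto.sup ?_ ?_
    · exact tendsto_const_nhds.congr' (eventually_mem_nhdsWithin.mono fun s hs =>
        (localEnergy_of_nonpos u T hs r).symm)
    · refine (hinit _ hK).congr' ?_
      filter_upwards [Ioc_mem_nhdsGT hT] with s hs
      exact (localEnergy_of_mem u hs r).symm
  · have hm : ContinuousOn (fun s => min s T) (Ioi 0) := by fun_prop
    have h := hE.comp hm fun s hs => ⟨lt_min hs hT, min_le_right _ _⟩
    refine (h.continuousAt (Ioi_mem_nhds ht)).congr ?_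
    filter_upwards [Ioi_mem_nhds ht] with s hs
    rw [localEnergy, if_neg (not_le.mpr hs), Function.comp_apply]

theorem localEnergy_le (hu : IsBiharmonicHeatSol u {p | p.2 ∈ Ioc 0 T}) (hT : 0 < T)
    (hinit : ∀ Ω : Set (EuclideanSpace ℝ (Fin n)), IsCompact Ω →
      Tendsto (fun t => ∫ x in Ω, (u x t) ^ 2) (nhdsWithin 0 (Ioi 0)) (nhds 0)) :
    ∃ C : ℝ, 0 < C ∧ ∀ ρ r τ t, 0 < ρ → ρ < r → τ ≤ t → t < T →
      localEnergy u T t ρ ≤ localEnergy u T τ r +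
        C / (r - ρ) ^ 4 * ∫ s in τ..t, localEnergy u T s r := by
  obtain ⟨C, hC, h⟩ := hu.energy_le
  refine ⟨C, hC, fun ρ r τ t hρ hr hτt htT => ?_⟩
  have hc := hu.continuous_localEnergy hT hinit r
  have hd : 0 < r - ρ := sub_pos.mpr hr
  have hI : 0 ≤ ∫ s in τ..t, localEnergy u T s r :=
    intervalIntegral.integral_nonneg hτt fun s _ => localEnergy_nonneg u T s r
  have hpos : ∀ σ, 0 < σ → σ ≤ t → localEnergy u T t ρ ≤ localEnergy u T σ r +
      C / (r - ρ) ^ 4 * ∫ s in σ..t, localEnergy u T s r := by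
    intro σ hσ hσt
    rw [localEnergy_of_mem u ⟨hσ.trans_le hσt, htT.le⟩, localEnergy_of_mem u ⟨hσ, hσt.trans htT.le⟩]
    refine (h ρ r σ t hρ hr hσ hσt htT).trans_eq ?_
    congr 2
    refine intervalIntegral.integral_congr fun s hs => ?_
    rw [uIcc_of_le hσt] at hs
    exact (localEnergy_of_mem u ⟨hσ.trans_le hs.1, hs.2.trans htT.le⟩ r).symm
  rcases lt_or_ge 0 τ with hτ | hτ
  · exact hpos τ hτ hτt
  rw [localEnergy_of_nonpos u T hτ]
  rcases le_or_gt t 0 with ht | ht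
  · rw [localEnergy_of_nonpos u T ht]
    positivity
  have hlim : Tendsto (fun σ => localEnergy u T σ r +
      C / (r - ρ) ^ 4 * ∫ s in τ..t, localEnergy u T s r) (nhdsWithin 0 (Ioi 0))
      (nhds (0 + C / (r - ρ) ^ 4 * ∫ s in τ..t, localEnergy u T s r)) := by
    refine Tendsto.add_const _ ?_
    have := hc.tendsto 0
    rw [localEnergy_of_nonpos u T le_rfl] at this
    exact this.mono_left nhdsWithin_le_nhds
  refine ge_of_tendsto hlim ?_
  filter_upwards [Ioc_mem_nhdsGT ht] with σ hσ
  refine (hpos σ hσ.1 hσ.2).trans ?_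
  gcongr
  exact intervalIntegral.integral_mono_interval (hτ.trans hσ.1.le) hσ.2 le_rfl
    (Eventually.of_forall fun s => localEnergy_nonneg u T s r) (hc.intervalIntegrable _ _)

theorem integral_localEnergy_le (hu : IsBiharmonicHeatSol u {p | p.2 ∈ Ioc 0 T}) (hT : 0 < T)
    (hinit : ∀ Ω : Set (EuclideanSpace ℝ (Fin n)), IsCompact Ω →
      Tendsto (fun t => ∫ x in Ω, (u x t) ^ 2) (nhdsWithin 0 (Ioi 0)) (nhds 0))
    {a : ℝ} (ha : 0 < a) {T' : ℝ} (hT' : 0 ≤ T') (hTT : T' ≤ T) {R : ℝ} (hR : 0 < R) :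
    ∫ s in (0 : ℝ)..T', s ^ a * localEnergy u T s R ≤
      ∫ t in Ioc (0 : ℝ) T, t ^ a * ∫ x in ball 0 R, (u x t) ^ 2 := by
  have hc : Continuous fun s => s ^ a * localEnergy u T s R :=
    (Real.continuous_rpow_const ha.le).mul (hu.continuous_localEnergy hT hinit R)
  rw [intervalIntegral.integral_of_le hT']
  calc _ ≤ ∫ s in Ioc (0 : ℝ) T, s ^ a * localEnergy u T s R := by
        refine setIntegral_mono_set (hc.integrableOn_Ioc) ?_
          (Ioc_subset_Ioc_right hTT).eventuallyLE
        refine (ae_restrict_mem measurableSet_Ioc).mono fun s hs => ?_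
        exact mul_nonneg (Real.rpow_nonneg hs.1.le a) (localEnergy_nonneg u T s R)
    _ = _ := by
        refine setIntegral_congr_fun measurableSet_Ioc fun s hs => ?_
        have hb : (closedBall 0 R : Set (EuclideanSpace ℝ (Fin n))) =ᵐ[volume] ball 0 R := by
          rw [ae_eq_set, closedBall_sdiff_ball, sdiff_eq_bot_iff.mpr ball_subset_closedBall]
          exact ⟨Measure.addHaar_sphere_of_ne_zero volume 0 hR.ne', measure_empty⟩
        beta_reduce
        rw [localEnergy_of_mem u hs, setIntegral_congr_set hb]

end IsBiharmonicHeatSol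

/-- Uniqueness for the Cauchy problem of the biharmonic heat equation on ℝⁿ
(Theorem 1.2 of the paper, Euclidean case): a solution on `ℝⁿ × (0,T]` with
vanishing initial data (in the local `L²` sense) satisfying the weighted
`L²` growth bound `∫₀ᵀ tᵃ ∫_{B(0,R)} u² ≤ e^{L(R)}` for a nondecreasing
positive `L` with `∫₁^∞ r³/L(r)³ dr = ∞` vanishes identically. -/
theorem biharmonic_heat_uniqueness
    (n : ℕ) (hn : 1 ≤ n) (T : ℝ) (hT : 0 < T)
    (u : EuclideanSpace ℝ (Fin n) → ℝ → ℝ)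
    (hu : IsBiharmonicHeatSol u {p | p.2 ∈ Set.Ioc 0 T})
    (hinit : ∀ Ω : Set (EuclideanSpace ℝ (Fin n)), IsCompact Ω →
      Tendsto (fun t => ∫ x in Ω, (u x t) ^ 2) (nhdsWithin 0 (Set.Ioi 0)) (nhds 0))
    (hgrowth : ∃ a : ℝ, 0 < a ∧ ∃ Rstar : ℝ, 1 ≤ Rstar ∧ ∃ L : ℝ → ℝ,
      MonotoneOn L (Set.Ici (1:ℝ)) ∧ (∀ r ∈ Set.Ici (1:ℝ), 0 < L r) ∧
      (∫⁻ r in Set.Ici (1:ℝ), ENNReal.ofReal (r ^ 3 / (L r) ^ 3) = ⊤) ∧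
      (∀ R, Rstar ≤ R →
        ∫ t in Set.Ioc (0:ℝ) T, t ^ a * ∫ x in Metric.ball 0 R, (u x t) ^ 2
          ≤ Real.exp (L R))) :
    ∀ x, ∀ t ∈ Set.Ioc (0:ℝ) T, u x t = 0 := by
  obtain ⟨a, ha, Rstar, hR1, L, hL, hL0, hdiv, hgrow⟩ := hgrowth
  obtain ⟨C, hC, hen⟩ := hu.localEnergy_le hT hinit
  have hzero : ∀ t ∈ Ioo 0 T, ∀ x, u x t = 0 := by
    intro t ht x
    have hE : localEnergy u T t (‖x‖ + 1) = 0 :=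
      energy_eq_zero (E := localEnergy u T) hC ha ht.1.le hR1 (localEnergy_nonneg u T)
        (hu.monotone_localEnergy hT) (hu.continuous_localEnergy hT hinit)
        (fun s hs => localEnergy_of_nonpos u T hs)
        (fun ρ r τ s hρ hr hτ hs => hen ρ r τ s hρ hr hτ (hs.trans_lt ht.2)) hL hL0 hdiv
        (fun R hR => by
          have h1 : 1 ≤ R := hR1.trans hR
          refine (hu.integral_localEnergy_le hT hinit ha ht.1.le ht.2.le
            (zero_lt_one.trans_le h1)).trans ((hgrow R hR).trans (Real.exp_le_exp.mpr ?_))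
          exact hL h1 (h1.trans (by linarith)) (by linarith)) t le_rfl _
    have hc : Continuous fun y => u y t ^ 2 :=
      (hu.contDiff_slice (Ioo_subset_Ioc_self ht)).continuous.pow 2
    rw [localEnergy_of_mem u (Ioo_subset_Ioc_self ht), setIntegral_eq_zero_iff_of_nonneg_ae
      (Eventually.of_forall fun y => sq_nonneg _)
      (hc.continuousOn.integrableOn_compact (isCompact_closedBall 0 _))] at hE
    have hE' : (fun y => u y t ^ 2) =ᵐ[volume.restrict (ball 0 (‖x‖ + 1))] fun _ => 0 :=
      ae_mono (Measure.restrict_mono_set _ ball_subset_closedBall) hE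
    have h := Measure.eqOn_open_of_ae_eq hE' isOpen_ball hc.continuousOn continuousOn_const
    exact pow_eq_zero_iff two_ne_zero |>.mp (h (by simp : x ∈ ball 0 (‖x‖ + 1)))
  intro x t ht
  have hcl : ContinuousOn (fun s => u x s) (Ioc 0 T) :=
    hu.1.continuousOn.comp (f := fun s => (x, s)) (by fun_prop) fun s hs => hs
  have hsub : EqOn (fun s => u x s) (fun _ => 0) (Ioc 0 T) :=
    EqOn.of_subset_closure (s := Ioo 0 T) (fun s hs => hzero s hs x) hcl continuousOn_const
      Ioo_subset_Ioc_self (by rw [closure_Ioo hT.ne]; exact Ioc_subset_Icc_self)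
  exact hsub ht
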